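/- No flower is a Burling graph: let G be made of a hole H such that each edge e of H lies in a hole H_e with V(H) ∩ V(H_e) = e, V(H_e) ∩ V(H_f) = e ∩ f for distinct edges e, f of H, and the only edges and vertices of G are those of the H_e's; then G is not a Burling graph. -/

import Mathlib

/-- An oriented graph on vertex type `V`: an irreflexive, asymmetric arc relation. -/
structure OrientedGraph (V : Type) where
  arc : V → V → Prop
  irrefl : ∀ v, ¬ arc v v
  asymm : ∀ u v, arc u v → ¬ arc v u

/-- A Burling tree `(T, root, lastBorn, choose)`.  The tree is encoded by its parent
function (with `parent root = root`); `lastBorn v` is a distinguished child of each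
non-leaf `v`; `choose v` is the vertex set of a (possibly empty) branch of the tree
starting at the last-born of the parent of `v` when `v` is neither the root nor a
last-born, and is empty otherwise. -/
structure BurlingTree (V : Type) where
  root : V
  parent : V → V
  parent_root : parent root = root
  reaches_root : ∀ v, ∃ n, parent^[n] v = root
  lastBorn : V → V
  lastBorn_child : ∀ v w, w ≠ root → parent w = v →
    lastBorn v ≠ root ∧ parent (lastBorn v) = v
  choose : V → Set V
  choose_root : choose root = ∅
  choose_lastBorn : ∀ v, v ≠ root → lastBorn (parent v) = v → choose v = ∅
  choose_branch : ∀ v, v ≠ root → lastBorn (parent v) ≠ v →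
    choose v = ∅ ∨ ∃ b, (∃ n, parent^[n] b = lastBorn (parent v)) ∧
      choose v = {x | (∃ n, parent^[n] x = lastBorn (parent v)) ∧ ∃ n, parent^[n] b = x}

namespace BurlingTree

variable {V : Type} (T : BurlingTree V)

/-- `u` is an ancestor of `v` in `T` (possibly `u = v`). -/
def Anc (u v : V) : Prop := ∃ n, T.parent^[n] v = u

/-- Arc relation of the oriented graph derived from `T` with vertex set `S`
(the induced subgraph, on `S`, of the graph fully derived from `T`). -/
def Arc (S : Set V) (u v : V) : Prop := u ∈ S ∧ v ∈ S ∧ v ∈ T.choose u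

/-- Underlying undirected graph of the derived graph on `S`. -/
def UGraph (S : Set V) : SimpleGraph V := SimpleGraph.fromRel (T.Arc S)

/-- Closed in-neighborhood `N⁻[v]` in the derived graph on `S`. -/
def InNbhd (S : Set V) (v : V) : Set V := insert v {u | T.Arc S u v}

/-- The top-set of the derived graph on `S`: vertices of `S` that are the unique
vertex of `S` on the branch of `T` from the root to them. -/
def TopSet (S : Set V) : Set V := {v | v ∈ S ∧ ∀ x ∈ S, T.Anc x v → x = v}

end BurlingTree

/-- Reachability between `u` and `w` inside the set `A` of vertices of `G`. -/
def ReachIn {V : Type} (G : SimpleGraph V) (A : Set V) (u w : V) : Prop :=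
  Relation.ReflTransGen (fun x y => x ∈ A ∧ y ∈ A ∧ G.Adj x y) u w

/-- `N⁻[v]` is a full in-star cutset of the graph derived from `T` on `S`. -/
def BurlingTree.IsFullInStarCutset {V : Type} (T : BurlingTree V) (S : Set V) (v : V) : Prop :=
  ∃ a ∈ S \ T.InNbhd S v, ∃ b ∈ S \ T.InNbhd S v,
    ¬ ReachIn (T.UGraph S) (S \ T.InNbhd S v) a b

/-- The arc relation `A` is an in-forest: a disjoint union of orientations of rooted
trees with all edges oriented towards the root.  Equivalently: it is irreflexive and
asymmetric, its underlying graph is a forest, every vertex has at most one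
out-neighbor, and from every vertex the unique outgoing directed path terminates in
a sink. -/
def IsInForestRel {V : Type} (A : V → V → Prop) : Prop :=
  (∀ v, ¬ A v v) ∧ (∀ u v, A u v → ¬ A v u) ∧
  (SimpleGraph.fromRel A).IsAcyclic ∧
  (∀ u v w, A u v → A u w → v = w) ∧
  (∀ v, ∃ r, Relation.ReflTransGen A v r ∧ ∀ w, ¬ A r w)

/-- The arc relation `A` forms an in-tree on the vertex set `U`:
an in-forest all of whose vertices in `U` reach a common root. -/
def IsInTreeOn {V : Type} (A : V → V → Prop) (U : Set V) : Prop :=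
  IsInForestRel A ∧ ∃ r ∈ U, ∀ v ∈ U, Relation.ReflTransGen A v r

/-- The graph with arc relation `A` and vertex set `U` is an oriented chandelier:
it is obtained from an in-tree `G'` (on `U` minus an apex `v`) with at least two
leaves by adding the vertex `v` and exactly the arcs from each leaf of `G'` to `v`.
A leaf of the in-tree is a source having exactly one out-neighbor. -/
def ChandelierOn {V : Type} (A : V → V → Prop) (U : Set V) : Prop :=
  ∃ v ∈ U,
    IsInTreeOn (fun a b => A a b ∧ a ≠ v ∧ b ≠ v) (U \ {v}) ∧
    (∀ u, ¬ A v u) ∧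
    (∀ u, A u v ↔ (u ∈ U ∧ u ≠ v ∧ (∀ w, ¬ (A w u ∧ w ≠ v ∧ u ≠ v)) ∧
       ∃ w, A u w ∧ w ≠ v ∧ u ≠ v)) ∧
    (∃ u₁ u₂, u₁ ≠ u₂ ∧ A u₁ v ∧ A u₂ v)

namespace OrientedGraph

variable {V : Type} (G : OrientedGraph V)

/-- Underlying undirected simple graph of an oriented graph. -/
def toSimpleGraph : SimpleGraph V := SimpleGraph.fromRel G.arc

/-- `G` is an in-forest. -/
def IsInForest : Prop := IsInForestRel G.arc

/-- `G` is an oriented chandelier. -/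
def IsChandelier : Prop := ChandelierOn G.arc Set.univ

/-- Closed in-neighborhood `N⁻[v]`. -/
def InNbhd (v : V) : Set V := insert v {u | G.arc u v}

/-- `G` has a full in-star cutset: for some vertex `v`, removing `N⁻[v]`
disconnects the underlying graph. -/
def HasFullInStarCutset : Prop :=
  ∃ v, ∃ a ∈ (G.InNbhd v)ᶜ, ∃ b ∈ (G.InNbhd v)ᶜ,
    ¬ ReachIn G.toSimpleGraph (G.InNbhd v)ᶜ a b

/-- `v` is a cut vertex of `G`: some two vertices distinct from `v` are connected
in the underlying graph but disconnected after removing `v`. -/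
def IsCutVertex (v : V) : Prop :=
  ∃ a b, a ≠ v ∧ b ≠ v ∧ G.toSimpleGraph.Reachable a b ∧
    ¬ ReachIn G.toSimpleGraph {v}ᶜ a b

/-- `G` is a `k`-Burling oriented graph: it is isomorphic to a graph derived from a
Burling tree `T` such that every branch of `T` contains at most `k` vertices of `G`. -/
def IsKBurling (k : ℕ) : Prop :=
  ∃ (W : Type) (T : BurlingTree W) (f : V → W),
    Function.Injective f ∧
    (∀ u v, G.arc u v ↔ T.Arc (Set.range f) (f u) (f v)) ∧
    ∀ b : W, ({x | x ∈ Set.range f ∧ T.Anc x b}).ncard ≤ k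

end OrientedGraph

/-- The graph with arc relation `A` on vertex set `U` is (isomorphic to) a graph
derived from some Burling tree. -/
def IsDerivedOn {V : Type} (A : V → V → Prop) (U : Set V) : Prop :=
  ∃ (W : Type) (T : BurlingTree W) (f : V → W),
    Set.InjOn f U ∧ ∀ a ∈ U, ∀ b ∈ U, (A a b ↔ f b ∈ T.choose (f a))

/-- `C` is a hole of the graph derived from `T` on `S`: an induced cycle of length
at least 4 of the underlying graph (a finite set of at least four vertices whose
induced subgraph is connected and 2-regular). -/
def BurlingTree.IsHole {V : Type} (T : BurlingTree V) (S : Set V) (C : Set V) : Prop :=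
  C ⊆ S ∧ C.Finite ∧ 4 ≤ C.ncard ∧
  (∀ x ∈ C, ({y | y ∈ C ∧ (T.UGraph S).Adj x y}).ncard = 2) ∧
  (∀ x ∈ C, ∀ y ∈ C, ReachIn (T.UGraph S) C x y)

/-- `p` is the pivot of the hole `C`: a sink of the hole both of whose neighbors in
the hole are sources of the hole (the antennas). -/
def BurlingTree.IsPivotOf {V : Type} (T : BurlingTree V) (S : Set V) (C : Set V) (p : V) : Prop :=
  p ∈ C ∧ (∀ w ∈ C, ¬ T.Arc S p w) ∧
  (∀ q ∈ C, (T.UGraph S).Adj p q → ∀ w ∈ C, ¬ T.Arc S w q)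

namespace BurlingTree

variable {V : Type} (T : BurlingTree V)

theorem anc_refl (u : V) : T.Anc u u := ⟨0, rfl⟩

theorem anc_trans {u v w : V} (h1 : T.Anc u v) (h2 : T.Anc v w) : T.Anc u w := by
  obtain ⟨n, hn⟩ := h1
  obtain ⟨m, hm⟩ := h2
  exact ⟨n + m, by rw [Function.iterate_add_apply, hm, hn]⟩

theorem anc_parent (v : V) : T.Anc (T.parent v) v := ⟨1, rfl⟩

theorem anc_cases {u v : V} (h : T.Anc u v) : u = v ∨ T.Anc u (T.parent v) := by
  obtain ⟨n, hn⟩ := h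
  cases n with
  | zero => exact Or.inl hn.symm
  | succ n => exact Or.inr ⟨n, hn⟩

theorem anc_chain {u v w : V} (h1 : T.Anc u w) (h2 : T.Anc v w) :
    T.Anc u v ∨ T.Anc v u := by
  obtain ⟨n, hn⟩ := h1
  obtain ⟨m, hm⟩ := h2
  rcases le_total n m with h | h
  · right
    refine ⟨m - n, ?_⟩
    rw [← hn, ← Function.iterate_add_apply, Nat.sub_add_cancel h, hm]
  · left
    refine ⟨n - m, ?_⟩
    rw [← hm, ← Function.iterate_add_apply, Nat.sub_add_cancel h, hn]

open Classical in
/-- Depth of a vertex in the tree. -/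
noncomputable def depth (v : V) : ℕ := Nat.find (T.reaches_root v)

theorem depth_parent {v : V} (h : v ≠ T.root) : T.depth v = T.depth (T.parent v) + 1 := by
  classical
  unfold depth
  exact Nat.find_comp_succ (T.reaches_root v) (T.reaches_root (T.parent v)) h

theorem anc_depth {u v : V} (h : T.Anc u v) : u = v ∨ T.depth u < T.depth v := by
  obtain ⟨n, hn⟩ := h
  induction n generalizing v with
  | zero => exact Or.inl hn.symm
  | succ n ih =>
    by_cases hv : v = T.root
    · subst hv
      rw [Function.iterate_succ_apply, T.parent_root] at hn
      exact ih hn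
    · have h1 := T.depth_parent hv
      rcases ih (v := T.parent v) hn with h | h
      · right; rw [h]; omega
      · right; omega

theorem anc_antisymm {u v : V} (h1 : T.Anc u v) (h2 : T.Anc v u) : u = v := by
  rcases T.anc_depth h1 with h | h
  · exact h
  · rcases T.anc_depth h2 with h' | h'
    · exact h'.symm
    · omega

/-- Strict descendants. -/
def Desc (v x : V) : Prop := T.Anc v x ∧ v ≠ x

theorem desc_asymm {u v : V} (h1 : T.Desc u v) (h2 : T.Desc v u) : False :=
  h1.2 (T.anc_antisymm h1.1 h2.1)

theorem desc_iff {v x : V} (hx : x ≠ T.root) : T.Desc v x ↔ T.Anc v (T.parent x) := by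
  constructor
  · rintro ⟨h1, h2⟩
    exact (T.anc_cases h1).resolve_left h2
  · intro h
    refine ⟨T.anc_trans h (T.anc_parent x), ?_⟩
    rintro rfl
    have h1 := T.depth_parent hx
    rcases T.anc_depth h with h2 | h2
    · rw [← h2] at h1; omega
    · omega

theorem desc_root {v : V} : ¬ T.Desc v T.root := by
  rintro ⟨⟨n, hn⟩, h2⟩
  apply h2
  rw [← hn]
  exact Function.iterate_fixed T.parent_root n

theorem choose_facts {u v : V} (h : v ∈ T.choose u) :
    u ≠ T.root ∧ T.lastBorn (T.parent u) ≠ u ∧ T.lastBorn (T.parent u) ≠ T.root ∧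
    T.parent (T.lastBorn (T.parent u)) = T.parent u ∧ T.Anc (T.lastBorn (T.parent u)) v ∧
    (∀ w, T.Anc (T.lastBorn (T.parent u)) w → T.Anc w v → w ∈ T.choose u) ∧
    (∀ w ∈ T.choose u, T.Anc w v ∨ T.Anc v w) := by
  have hu : u ≠ T.root := by
    rintro rfl
    rw [T.choose_root] at h; exact h
  have hl : T.lastBorn (T.parent u) ≠ u := by
    intro hl
    rw [T.choose_lastBorn u hu hl] at h; exact h
  obtain ⟨h1, h2⟩ := T.lastBorn_child (T.parent u) u hu rfl
  rcases T.choose_branch u hu hl with h3 | ⟨b, hb, h3⟩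
  · rw [h3] at h; exact h.elim
  · have hv : T.Anc (T.lastBorn (T.parent u)) v ∧ T.Anc v b := by
      rw [h3] at h; exact h
    refine ⟨hu, hl, h1, h2, hv.1, ?_, ?_⟩
    · intro w hw1 hw2
      rw [h3]
      exact ⟨hw1, T.anc_trans hw2 hv.2⟩
    · intro w hw
      rw [h3] at hw
      exact T.anc_chain hw.2 hv.2

theorem choose_depth {u v : V} (h : v ∈ T.choose u) :
    T.depth u < T.depth v ∨ (T.depth u = T.depth v ∧ T.choose v = ∅) := by
  obtain ⟨h1, h2, h3, h4, h5, -, -⟩ := T.choose_facts h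
  have e1 := T.depth_parent h1
  have e2 := T.depth_parent h3
  rw [h4] at e2
  rcases T.anc_depth h5 with h | h
  · right
    subst h
    refine ⟨by omega, T.choose_lastBorn _ h3 (by rw [h4])⟩
  · left; omega

theorem anc_same_depth {u v : V} (h : T.Anc u v) (hd : T.depth u = T.depth v) : u = v := by
  rcases T.anc_depth h with h | h
  · exact h
  · omega

theorem choose_incomp {u v : V} (h : v ∈ T.choose u) : ¬ T.Anc u v ∧ ¬ T.Anc v u := by
  obtain ⟨h1, h2, h3, h4, h5, -, -⟩ := T.choose_facts h
  have e1 := T.depth_parent h1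
  have e2 := T.depth_parent h3
  rw [h4] at e2
  constructor
  · intro h6
    rcases T.anc_chain h5 h6 with h7 | h7
    · exact h2 (T.anc_same_depth h7 (by omega))
    · exact h2 (T.anc_same_depth h7 (by omega)).symm
  · intro h6
    exact h2 (T.anc_same_depth (T.anc_trans h5 h6) (by omega))

theorem choose_asymm {u v : V} (h : v ∈ T.choose u) : u ∉ T.choose v := by
  intro h'
  rcases T.choose_depth h with h1 | ⟨h1, h2⟩
  · rcases T.choose_depth h' with h3 | h3 <;> omega
  · rw [h2] at h'; exact h'

theorem adj_iff {S : Set V} {x y : V} :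
    (T.UGraph S).Adj x y ↔ x ∈ S ∧ y ∈ S ∧ (y ∈ T.choose x ∨ x ∈ T.choose y) := by
  unfold UGraph
  rw [SimpleGraph.fromRel_adj]
  unfold Arc
  constructor
  · tauto
  · rintro ⟨h1, h2, h3⟩
    refine ⟨?_, by tauto⟩
    rintro rfl
    rcases h3 with h3 | h3 <;> exact (T.choose_incomp h3).1 (T.anc_refl _)

/-- `N⁻[v]` separates the strict descendants of `v`. -/
theorem separation {S : Set V} {v x y : V} (h : (T.UGraph S).Adj x y)
    (hx : T.Desc v x) (hy : ¬ T.Desc v y) : v ∈ T.choose y := by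
  obtain ⟨-, -, h | h⟩ := T.adj_iff.1 h
  · exfalso
    obtain ⟨h1, h2, h3, h4, h5, -, -⟩ := T.choose_facts h
    have h6 : T.Desc v (T.lastBorn (T.parent x)) := by
      rw [T.desc_iff h3, h4, ← T.desc_iff h1]; exact hx
    apply hy
    refine ⟨T.anc_trans h6.1 h5, ?_⟩
    rintro rfl
    exact h6.2 (T.anc_antisymm h6.1 h5)
  · obtain ⟨h1, h2, h3, h4, h5, h6, -⟩ := T.choose_facts h
    rcases T.anc_chain h5 hx.1 with h7 | h7
    · exact h6 v h7 hx.1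
    · by_cases h8 : v = T.lastBorn (T.parent y)
      · exact h6 v (h8 ▸ T.anc_refl _) hx.1
      · exfalso
        apply hy
        rw [T.desc_iff h1, ← h4, ← T.desc_iff h3]
        exact ⟨h7, h8⟩

end BurlingTree

theorem reachIn_cross {V : Type} {G : SimpleGraph V} {C A : Set V} {a b : V}
    (h : ReachIn G C a b) (ha : a ∈ A) (hb : b ∉ A) :
    ∃ x y, x ∈ C ∧ y ∈ C ∧ x ∈ A ∧ y ∉ A ∧ G.Adj x y := by
  unfold ReachIn at h
  induction h with
  | refl => exact absurd ha hb
  | @tail c d hac hcd ih =>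
    by_cases hc : c ∈ A
    · exact ⟨c, d, hcd.1, hcd.2.1, hc, hb, hcd.2.2⟩
    · exact ih hc

theorem ncard_two_mem {V : Type} {s : Set V} (h : s.ncard = 2) {a b : V} (ha : a ∈ s)
    (hb : b ∈ s) (hab : a ≠ b) : ∀ z ∈ s, z = a ∨ z = b := by
  obtain ⟨x, y, hxy, rfl⟩ := Set.ncard_eq_two.1 h
  intro z hz
  simp only [Set.mem_insert_iff, Set.mem_singleton_iff] at *
  grind

/-- A cycle remains connected after deleting one vertex. -/
theorem cycle_cut {V : Type} {G : SimpleGraph V} {C : Set V} (hfin : C.Finite)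
    (hdeg : ∀ x ∈ C, ({y | y ∈ C ∧ G.Adj x y}).ncard = 2)
    (hconn : ∀ x ∈ C, ∀ y ∈ C, ReachIn G C x y) (u : V) (hu : u ∈ C) (A : Set V) {a b : V}
    (ha : a ∈ C) (haA : a ∈ A) (hau : a ≠ u) (hb : b ∈ C) (hbA : b ∉ A) (hbu : b ≠ u) :
    ∃ x y, x ∈ C ∧ y ∈ C ∧ x ≠ u ∧ y ≠ u ∧ x ∈ A ∧ y ∉ A ∧ G.Adj x y := by
  classical
  by_contra hno
  have hno' : ∀ x y, x ∈ C → y ∈ C → x ≠ u → y ≠ u → x ∈ A → G.Adj x y → y ∈ A := by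
    intro x y h1 h2 h3 h4 h5 h6
    by_contra h7
    exact hno ⟨x, y, h1, h2, h3, h4, h5, h7, h6⟩
  obtain ⟨n, y, hnC, hyC, hnA, hyA, hny⟩ :=
    reachIn_cross (A := A \ {u}) (hconn a ha b hb) ⟨haA, hau⟩ (fun h => hbA h.1)
  have hyu : y = u := by
    by_contra h
    exact hyA ⟨hno' n y hnC hyC hnA.2 h hnA.1 hny, h⟩
  subst hyu
  obtain ⟨m, y', hmC, hyC', hmA, hyA', hmy⟩ :=
    reachIn_cross (A := Aᶜ \ {y}) (hconn b hb a ha) ⟨hbA, hbu⟩ (fun h => h.1 haA)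
  have hyu' : y' = y := by
    by_contra h
    refine hyA' ⟨fun h' => ?_, h⟩
    exact hmA.1 (hno' y' m hyC' hmC h hmA.2 h' hmy.symm)
  subst hyu'
  have hnm : n ≠ m := fun h => hmA.1 (h ▸ hnA.1)
  have hnbr := ncard_two_mem (hdeg y' hyC') (a := n) (b := m) ⟨hnC, hny.symm⟩ ⟨hmC, hmy.symm⟩ hnm
  let B : Set V := {x | x ∈ C ∧ x ∈ A ∧ x ≠ y'}
  have hBfin : B.Finite := hfin.subset (fun x hx => hx.1)
  haveI : Fintype B := hBfin.fintype
  let K : SimpleGraph B := G.induce B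
  have hdegK : ∀ x : B, K.degree x = ({y | y ∈ B ∧ G.Adj x y}).ncard := by
    intro x
    rw [← SimpleGraph.card_neighborSet_eq_degree, ← Nat.card_eq_fintype_card,
      Nat.card_coe_set_eq]
    rw [← Set.ncard_image_of_injective _ Subtype.val_injective]
    congr 1
    ext z
    simp only [Set.mem_image, SimpleGraph.mem_neighborSet, Set.mem_setOf_eq, Subtype.exists,
      exists_and_right, exists_eq_right]
    constructor
    · rintro ⟨h1, h2⟩
      exact ⟨h1, h2⟩
    · rintro ⟨h1, h2⟩
      exact ⟨h1, h2⟩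
  have hnB : n ∈ B := ⟨hnC, hnA.1, hnA.2⟩
  have h1 : K.degree ⟨n, hnB⟩ = 1 := by
    rw [hdegK]
    have : {y | y ∈ B ∧ G.Adj n y} = {y | y ∈ C ∧ G.Adj n y} \ {y'} := by
      ext z
      constructor
      · rintro ⟨h1, h2⟩
        exact ⟨⟨h1.1, h2⟩, h1.2.2⟩
      · rintro ⟨⟨h1, h2⟩, h3⟩
        exact ⟨⟨h1, hno' n z hnC h1 hnA.2 h3 hnA.1 h2, h3⟩, h2⟩
    have hmem : y' ∈ {y | y ∈ C ∧ G.Adj n y} := ⟨hyC', hny⟩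
    have h5 := Set.ncard_sdiff_singleton_of_mem hmem
    rw [hdeg n hnC] at h5
    exact (congrArg Set.ncard this).trans h5
  obtain ⟨w, hw1, hw2⟩ := K.exists_ne_odd_degree_of_exists_odd_degree ⟨n, hnB⟩ (by rw [h1]; decide)
  obtain ⟨w, hwB⟩ := w
  have h2 : K.degree ⟨w, hwB⟩ = 2 := by
    rw [hdegK, ← hdeg w hwB.1]
    congr 1
    ext z
    constructor
    · rintro ⟨h1, h2⟩
      exact ⟨h1.1, h2⟩
    · rintro ⟨h1, h2⟩
      have hz : z ≠ y' := by
        rintro rfl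
        rcases hnbr w ⟨hwB.1, h2.symm⟩ with h | h
        · exact hw1 (Subtype.ext h)
        · exact hmA.1 (h ▸ hwB.2.1)
      exact ⟨⟨h1, hno' w z hwB.1 h1 hwB.2.2 hz hwB.2.1 h2, hz⟩, h2⟩
  rw [h2] at hw2
  exact absurd hw2 (by decide)

namespace BurlingTree

variable {V : Type} (T : BurlingTree V)

/-- Cutting a hole along the strict descendants of `v`, avoiding `u`. -/
theorem hole_cut {S C : Set V} (hC : T.IsHole S C) {u v a b : V} (hu : u ∈ C)
    (ha : a ∈ C) (hau : a ≠ u) (hva : T.Desc v a)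
    (hb : b ∈ C) (hbu : b ≠ u) (hvb : ¬ T.Desc v b) :
    ∃ x y, x ∈ C ∧ y ∈ C ∧ x ≠ u ∧ y ≠ u ∧ T.Desc v x ∧ ¬ T.Desc v y ∧
      (T.UGraph S).Adj x y ∧ v ∈ T.choose y := by
  obtain ⟨-, hfin, -, hdeg, hconn⟩ := hC
  obtain ⟨x, y, h1, h2, h3, h4, h5, h6, h7⟩ :=
    cycle_cut hfin hdeg hconn u hu {x | T.Desc v x} ha hva hau hb hvb hbu
  exact ⟨x, y, h1, h2, h3, h4, h5, h6, h7, T.separation h7 h5 h6⟩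

theorem exists_source {S C : Set V} (hC : T.IsHole S C) :
    ∃ u ∈ C, ∀ w ∈ C, u ∉ T.choose w := by
  obtain ⟨-, hfin, h4, -, -⟩ := hC
  have hne : C.Nonempty := by
    rw [← Set.ncard_pos hfin]; omega
  obtain ⟨u, hu, hmin⟩ := Set.exists_min_image C T.depth hfin hne
  by_cases h : ∀ w ∈ C, u ∉ T.choose w
  · exact ⟨u, hu, h⟩
  · push Not at h
    obtain ⟨w, hw, huw⟩ := h
    refine ⟨w, hw, fun z hz hwz => ?_⟩
    have h1 := hmin w hw
    have h2 := hmin z hz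
    rcases T.choose_depth huw with h3 | ⟨h3, -⟩
    · omega
    · rcases T.choose_depth hwz with h5 | ⟨h5, h6⟩
      · omega
      · rw [h6] at huw; exact huw

/-- `s` is an antenna of the hole `C` with pivot `p` and other out-neighbor `x`. -/
def Ant (S C : Set V) (p s x : V) : Prop :=
  s ∈ C ∧ x ∈ C ∧ p ∈ T.choose s ∧ x ∈ T.choose s ∧ T.Desc p x ∧
    ∀ z ∈ C, (T.UGraph S).Adj s z → z ∈ T.choose s

theorem hole_pivot {S C : Set V} (hC : T.IsHole S C) :
    ∃ p s₁ s₂ x₁ x₂, p ∈ C ∧ s₁ ≠ s₂ ∧ T.Ant S C p s₁ x₁ ∧ T.Ant S C p s₂ x₂ ∧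
      ∀ z ∈ C, z ≠ p → z ≠ s₁ → z ≠ s₂ → T.Desc p z := by
  obtain ⟨u, hu, hsrc⟩ := T.exists_source hC
  have hC' := hC
  obtain ⟨hCS, hfin, -, hdeg, hconn⟩ := hC'
  obtain ⟨v, v', hvC, hv'C, huv, huv', hD⟩ : ∃ v v', v ∈ C ∧ v' ∈ C ∧
      v ∈ T.choose u ∧ v' ∈ T.choose u ∧ T.Desc v v' := by
    obtain ⟨a, b, hab, hN⟩ := Set.ncard_eq_two.1 (hdeg u hu)
    have ha : a ∈ {y | y ∈ C ∧ (T.UGraph S).Adj u y} := by rw [hN]; simp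
    have hb : b ∈ {y | y ∈ C ∧ (T.UGraph S).Adj u y} := by rw [hN]; simp
    have ha' := (T.adj_iff.1 ha.2).2.2.resolve_right (hsrc a ha.1)
    have hb' := (T.adj_iff.1 hb.2).2.2.resolve_right (hsrc b hb.1)
    rcases (T.choose_facts ha').2.2.2.2.2.2 b hb' with h | h
    · exact ⟨b, a, hb.1, ha.1, hb', ha', h, hab.symm⟩
    · exact ⟨a, b, ha.1, hb.1, ha', hb', h, hab⟩
  have hne : ∀ {x y : V}, y ∈ T.choose x → y ≠ x := by
    rintro x y h rfl
    exact (T.choose_incomp h).1 (T.anc_refl _)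
  obtain ⟨x, y, hxC, hyC, hxu, hyu, hvx, hvy, hxy, hyv⟩ :=
    T.hole_cut hC hu hv'C (hne huv') hD hvC (hne huv) (fun h => h.2 rfl)
  have hyx : x ∈ T.choose y := by
    rcases (T.adj_iff.1 hxy).2.2 with h | h
    · exfalso
      have := T.separation (v := v) hxy hvx hvy
      obtain ⟨h1, h2, h3, h4, h5, -, -⟩ := T.choose_facts h
      have h6 : T.Desc v (T.lastBorn (T.parent x)) := by
        rw [T.desc_iff h3, h4, ← T.desc_iff h1]; exact hvx
      exact (T.choose_incomp hyv).2 (T.anc_trans h6.1 h5)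
    · exact h
  have adj : ∀ {a b : V}, a ∈ C → b ∈ C → b ∈ T.choose a → (T.UGraph S).Adj a b :=
    fun ha hb h => T.adj_iff.2 ⟨hCS ha, hCS hb, Or.inl h⟩
  have hNv := ncard_two_mem (hdeg v hvC) (a := u) (b := y)
    ⟨hu, (adj hu hvC huv).symm⟩ ⟨hyC, (adj hyC hvC hyv).symm⟩ hyu.symm
  have hNy := ncard_two_mem (hdeg y hyC) (a := v) (b := x)
    ⟨hvC, adj hyC hvC hyv⟩ ⟨hxC, hxy.symm⟩ hvx.2
  refine ⟨v, u, y, v', x, hvC, hyu.symm, ⟨hu, hv'C, huv, huv', hD, ?_⟩,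
    ⟨hyC, hxC, hyv, hyx, hvx, ?_⟩, ?_⟩
  · intro z hz h
    exact (T.adj_iff.1 h).2.2.resolve_right (hsrc z hz)
  · intro z hz h
    rcases hNy z ⟨hz, h⟩ with rfl | rfl
    · exact hyv
    · exact hyx
  · intro z hz hzv hzu hzy
    by_contra hvz
    obtain ⟨a, b, haC, hbC, hau, hbu, haA, hbA, hab⟩ :=
      cycle_cut hfin hdeg hconn u hu {w | T.Desc v w ∨ w = v ∨ w = y} hv'C (Or.inl hD) (hne huv')
        hz (by rintro (h | h | h) <;> contradiction) hzu
    simp only [Set.mem_setOf_eq, not_or] at haA hbA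
    rcases haA with h | h | h
    · have h1 := T.separation hab h hbA.1
      rcases hNv b ⟨hbC, (adj hbC hvC h1).symm⟩ with h2 | h2
      · exact hbu h2
      · exact hbA.2.2 h2
    · rw [h] at hab
      rcases hNv b ⟨hbC, hab⟩ with h2 | h2
      · exact hbu h2
      · exact hbA.2.2 h2
    · rw [h] at hab
      rcases hNy b ⟨hbC, hab⟩ with h2 | h2
      · exact hbA.2.1 h2
      · exact hbA.1 (h2 ▸ hvx)

end BurlingTree

/-- No flower is a Burling graph: no graph derived from a Burling
tree is made of a hole `H` together with, for each edge `{a,b}` of `H`, a hole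
`He a b` meeting `H` exactly in `{a,b}`, with `He a b ∩ He a' b' = {a,b} ∩ {a',b'}`
for distinct edges, and whose vertices and edges are exactly those of the `He`'s. -/
theorem stmt19 (V : Type) (T : BurlingTree V) (S : Set V) (H : Set V)
    (He : V → V → Set V)
    (hH : T.IsHole S H)
    (hsym : ∀ a b, He a b = He b a)
    (hhole : ∀ a b, a ∈ H → b ∈ H → (T.UGraph S).Adj a b →
      T.IsHole S (He a b) ∧ H ∩ He a b = {a, b})
    (hinter : ∀ a b a' b', a ∈ H → b ∈ H → a' ∈ H → b' ∈ H →
      (T.UGraph S).Adj a b → (T.UGraph S).Adj a' b' →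
      ¬ (a = a' ∧ b = b') → ¬ (a = b' ∧ b = a') →
      He a b ∩ He a' b' = ({a, b} ∩ {a', b'} : Set V))
    (hcover : S = {x | ∃ a b, a ∈ H ∧ b ∈ H ∧ (T.UGraph S).Adj a b ∧ x ∈ He a b})
    (hedges : ∀ x y, (T.UGraph S).Adj x y →
      ∃ a b, a ∈ H ∧ b ∈ H ∧ (T.UGraph S).Adj a b ∧ x ∈ He a b ∧ y ∈ He a b) :
    False := by
  classical
  have hH' := hH
  obtain ⟨hHS, -, -, -, -⟩ := hH'
  have key : ∀ a b c d, a ∈ H → b ∈ H → (T.UGraph S).Adj a b →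
      c ∈ He a b → c ∉ H → (T.UGraph S).Adj c d → d ∈ He a b := by
    intro a b c d ha hb hab hc hcH hcd
    obtain ⟨a', b', ha', hb', hab', h1, h2⟩ := hedges c d hcd
    by_cases e1 : a = a' ∧ b = b'
    · obtain ⟨rfl, rfl⟩ := e1; exact h2
    by_cases e2 : a = b' ∧ b = a'
    · obtain ⟨rfl, rfl⟩ := e2; rw [hsym]; exact h2
    exfalso
    have h3 : c ∈ He a b ∩ He a' b' := ⟨hc, h1⟩
    rw [hinter a b a' b' ha hb ha' hb' hab hab' e1 e2] at h3
    rcases h3.1 with h4 | h4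
    · exact hcH (h4 ▸ ha)
    · exact hcH (h4 ▸ hb)
  obtain ⟨p, s₁, s₂, x₁, x₂, hp, hs, hA₁, hA₂, -⟩ := T.hole_pivot hH
  have step : ∀ s x, T.Ant S H p s x → (T.UGraph S).Adj s p ∧ T.IsHole S (He s p) ∧
      s ∈ H ∧ H ∩ He s p = {s, p} ∧ p ≠ s ∧
      ∃ q ∈ He s p, T.Desc q p ∧ q ∉ H := by
    rintro s x ⟨hsH, hxH, hsp, hsx, hpx, -⟩
    have hadj : (T.UGraph S).Adj s p := T.adj_iff.2 ⟨hHS hsH, hHS hp, Or.inl hsp⟩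
    obtain ⟨hC, hCH⟩ := hhole s p hsH hp hadj
    have hps : p ≠ s := hadj.ne'
    have hxs : x ≠ s := by
      rintro rfl; exact (T.choose_incomp hsx).1 (T.anc_refl _)
    have hpC : p ∈ He s p := by
      have : p ∈ H ∩ He s p := by rw [hCH]; simp
      exact this.2
    have hsC : s ∈ He s p := by
      have : s ∈ H ∩ He s p := by rw [hCH]; simp
      exact this.2
    have hint : ∀ z, z ∈ H → z ∈ He s p → z = s ∨ z = p := by
      intro z h1 h2
      have : z ∈ H ∩ He s p := ⟨h1, h2⟩
      rw [hCH] at this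
      simpa using this
    have hxC : x ∉ He s p := by
      intro h
      rcases hint x hxH h with h | h
      · exact hxs h
      · exact hpx.2 h.symm
    refine ⟨hadj, hC, hsH, hCH, hps, ?_⟩
    obtain ⟨q, a₁, a₂, r₁, r₂, hq, ha, hB₁, hB₂, hall⟩ := T.hole_pivot hC
    have noant : ∀ r, T.Ant S (He s p) p s r → False := by
      rintro r ⟨-, hrC, -, hsr, hpr, -⟩
      have hrs : r ≠ s := by
        rintro rfl; exact (T.choose_incomp hsr).1 (T.anc_refl _)
      have hrx : r ≠ x := by rintro rfl; exact hxC hrC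
      have hrH : r ∉ H := by
        intro h
        rcases hint r h hrC with h | h
        · exact hrs h
        · exact hpr.2 h.symm
      rcases (T.choose_facts hsx).2.2.2.2.2.2 r hsr with h | h
      · obtain ⟨c, d, hc, hd, hcs, hds, -, -, -, hdr⟩ := T.hole_cut hH (v := r) hsH hxH hxs ⟨h, hrx⟩
          hp hps (fun h => T.desc_asymm h hpr)
        have hdC := key s p r d hsH hp hadj hrC hrH
          (T.adj_iff.2 ⟨hC.1 hrC, hHS hd, Or.inr hdr⟩)
        rcases hint d hd hdC with h | h
        · exact hds h
        · exact (T.choose_incomp hdr).1 (h ▸ hpr.1)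
      · obtain ⟨c, d, hc, hd, hcs, hds, -, -, -, hdx⟩ := T.hole_cut hC (v := x) hsC hrC hrs
          ⟨h, hrx.symm⟩ hpC hps (fun h => T.desc_asymm h hpx)
        obtain ⟨a', b', ha', hb', hab', h1, h2⟩ := hedges d x
          (T.adj_iff.2 ⟨hC.1 hd, hHS hxH, Or.inl hdx⟩)
        have e1 : ¬ (s = a' ∧ p = b') := by rintro ⟨rfl, rfl⟩; exact hxC h2
        have e2 : ¬ (s = b' ∧ p = a') := by
          rintro ⟨rfl, rfl⟩; rw [hsym] at h2; exact hxC h2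
        have h3 : d ∈ He s p ∩ He a' b' := ⟨hd, h1⟩
        rw [hinter s p a' b' hsH hp ha' hb' hadj hab' e1 e2] at h3
        rcases h3.1 with h4 | h4
        · exact hds h4
        · have h5 : d = p := h4
          exact (T.choose_incomp hdx).1 (h5 ▸ hpx.1)
    have hqp : q ≠ p := by
      rintro rfl
      have hnd : ¬ T.Desc q s := fun h => (T.choose_incomp hsp).2 h.1
      by_cases h1 : s = a₁
      · subst h1; exact noant _ hB₁
      by_cases h2 : s = a₂
      · subst h2; exact noant _ hB₂
      exact hnd (hall s hsC hps.symm h1 h2)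
    have hpa : ∀ a r, T.Ant S (He s p) q a r → p ≠ a := by
      rintro a r ⟨-, -, -, -, -, h⟩ rfl
      exact T.choose_asymm hsp (h s hsC hadj.symm)
    have hqd : T.Desc q p := hall p hpC hqp.symm (hpa _ _ hB₁) (hpa _ _ hB₂)
    refine ⟨q, hq, hqd, fun h => ?_⟩
    rcases hint q h hq with h | h
    · exact (T.choose_incomp hsp).1 (h ▸ hqd.1)
    · exact hqp h
  obtain ⟨hadj₁, hC₁, hs₁, hCH₁, hps₁, q₁, hq₁, hd₁, hqH₁⟩ := step s₁ x₁ hA₁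
  obtain ⟨hadj₂, hC₂, hs₂, hCH₂, hps₂, q₂, hq₂, hd₂, hqH₂⟩ := step s₂ x₂ hA₂
  have final : ∀ s t q q', s ≠ t → s ∈ H → t ∈ H → p ≠ t → (T.UGraph S).Adj s p →
      (T.UGraph S).Adj t p → T.IsHole S (He t p) → T.IsHole S (He s p) →
      H ∩ He t p = {t, p} → q ∈ He s p → q ∉ H →
      T.Desc q p → q' ∈ He t p → q' ∉ H → T.Desc q q' := by
    intro s t q q' hst hsH htH hpt hsp htp hCt hCs hCH hq hqH hqp hq' hqH'
    by_contra hcon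
    have htC : t ∈ H ∩ He t p := by rw [hCH]; simp
    have hpC : p ∈ H ∩ He t p := by rw [hCH]; simp
    obtain ⟨c, d, hc, hd, hct, hdt, -, -, -, hdq⟩ := T.hole_cut hCt htC.2 hpC.2 hpt hqp hq'
      (fun h => hqH' (h ▸ htH)) hcon
    have hdC := key s p q d hsH hp hsp hq hqH
      (T.adj_iff.2 ⟨hCs.1 hq, hCt.1 hd, Or.inr hdq⟩)
    have h3 : d ∈ He s p ∩ He t p := ⟨hdC, hd⟩
    rw [hinter s p t p hsH hp htH hp hsp htp (fun h => hst h.1) (fun h => hpt h.2)] at h3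
    rcases h3.2 with h4 | h4
    · exact hdt h4
    · have h5 : d = p := h4
      exact (T.choose_incomp hdq).2 (h5 ▸ hqp.1)
  exact T.desc_asymm
    (final s₁ s₂ q₁ q₂ hs hs₁ hs₂ hps₂ hadj₁ hadj₂ hC₂ hC₁ hCH₂ hq₁ hqH₁ hd₁ hq₂ hqH₂)
    (final s₂ s₁ q₂ q₁ hs.symm hs₂ hs₁ hps₁ hadj₂ hadj₁ hC₁ hC₂ hCH₁ hq₂ hqH₂ hd₂ hq₁ hqH₁)
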